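/- There exists an absolute constant C₂ > 0 such that for all N sufficiently large (depending on C₂) and any 1 ≤ k ≤ (log N)/2: if Y_1,…,Y_k are i.i.d. uniform random vectors in Σ_N, then the probability that (Y_1,…,Y_k) is not admissible is at most N^{-2^k}. -/

import Mathlib

open scoped Classical

noncomputable section

/-- A point of the discrete cube `Σ_N = {-1,1}^N`, encoded by booleans
(`true ↦ +1`, `false ↦ -1`). -/
abbrev Cube (N : ℕ) := Fin N → Bool

/-- The sign-switching action of `g ∈ Σ_N` on `x ∈ Σ_N`: `(g∘x)^i = g^i x^i`.
In the boolean encoding the product of signs `g^i x^i` is `+1` iff `g^i = x^i`. -/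
def signSwitch {N : ℕ} (g : Cube N) (x : Cube N) : Cube N := fun i => g i == x i

/-- For a tuple `Y = (y_1, …, y_{k+1}) ∈ Σ_N^{k+1}` (a tuple of length `k+1`,
so that the number of vectors is at least one) and a sign pattern
`a ∈ {-1,1}^k`, the set `I_a(Y)` of positions `j ∈ [N]` such that the `j`-th
component of `y_1 ∘ y_{i+1}` equals `a_i` for every `i = 1, …, k`. -/
def Ia {N k : ℕ} (Y : Fin (k + 1) → Cube N) (a : Fin k → Bool) : Set (Fin N) :=
  {j | ∀ i : Fin k, signSwitch (Y 0) (Y i.succ) j = a i}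

/-- The record `φ_I(Y) = (I_a(Y))_{a ∈ {-1,1}^k}`. -/
def phiI {N k : ℕ} (Y : Fin (k + 1) → Cube N) : (Fin k → Bool) → Set (Fin N) :=
  fun a => Ia Y a

/-- The probability of an event `E` under the uniform distribution on a finite
type (modelling i.i.d. uniform random vectors). -/
def unifP {α : Type*} [Fintype α] (E : Set α) : ℝ :=
  (E.ncard : ℝ) / (Fintype.card α)

/-- A tuple `Y ∈ Σ_N^{k+1}` is admissible (with constant `C₂`) if
`||I_a(Y)| - 2^{-k} N| ≤ C₂ (N log N)^{1/2}` for every sign pattern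
`a ∈ {-1,1}^k`. -/
def Admissible {N k : ℕ} (C₂ : ℝ) (Y : Fin (k + 1) → Cube N) : Prop :=
  ∀ a : Fin k → Bool,
    |((Ia Y a).ncard : ℝ) - (2 : ℝ) ^ (-(k : ℝ)) * N| ≤
      C₂ * Real.sqrt (N * Real.log N)

lemma col_sum (k : ℕ) (a : Fin k → Bool) (E : ℝ) :
    ∑ c : Fin (k + 1) → Bool, (if ∀ i : Fin k, (c 0 == c i.succ) = a i then E else 1)
      = 2 * ((2 : ℝ) ^ k - 1 + E) := by
  rw [← (Fin.consEquiv (fun _ : Fin (k + 1) => Bool)).sum_comp]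
  rw [Fintype.sum_prod_type]
  have h : ∀ b : Bool, ∑ t : Fin k → Bool,
      (if ∀ i : Fin k, (b == t i) = a i then E else 1) = (2 : ℝ) ^ k - 1 + E := by
    intro b
    have h1 : ∀ t : Fin k → Bool, (if ∀ i : Fin k, (b == t i) = a i then E else 1)
        = 1 + (if t = (fun i => (b == a i)) then E - 1 else 0) := by
      intro t
      have : (∀ i : Fin k, (b == t i) = a i) ↔ t = (fun i => (b == a i)) := by
        rw [funext_iff]
        refine forall_congr' fun i => ?_
        cases b <;> cases t i <;> cases a i <;> simp
      by_cases h : t = (fun i => (b == a i))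
      · rw [if_pos (this.2 h), if_pos h]; ring
      · rw [if_neg (fun h' => h (this.1 h')), if_neg h]; ring
    rw [Finset.sum_congr rfl (fun t _ => h1 t), Finset.sum_add_distrib]
    simp
    ring
  have h2 : ∀ b : Bool, ∑ t : Fin k → Bool,
      (if ∀ i : Fin k, ((Fin.consEquiv (fun _ : Fin (k + 1) => Bool)) (b, t) 0 ==
        (Fin.consEquiv (fun _ : Fin (k + 1) => Bool)) (b, t) i.succ) = a i then E else 1)
      = (2 : ℝ) ^ k - 1 + E := by
    intro b
    rw [← h b]
    simp [Fin.consEquiv]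
  rw [Finset.sum_congr rfl (fun b _ => h2 b)]
  simp
  ring

lemma mgf (N k : ℕ) (a : Fin k → Bool) (μ : ℝ) :
    ∑ Y : Fin (k + 1) → Cube N, Real.exp (μ * ((Ia Y a).ncard : ℝ))
      = (2 * ((2 : ℝ) ^ k - 1 + Real.exp μ)) ^ N := by
  rw [← col_sum k a, Fintype.sum_pow]
  rw [← (Equiv.piComm (fun (_ : Fin N) (_ : Fin (k + 1)) => Bool)).sum_comp]
  refine Finset.sum_congr rfl fun Z _ => ?_
  rw [Set.ncard_eq_toFinset_card']
  rw [Finset.prod_ite]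
  simp only [Finset.prod_const, one_pow, mul_one]
  rw [mul_comm, Real.exp_nat_mul]
  congr 2
  ext j
  rw [Set.mem_toFinset, Finset.mem_filter]
  exact ⟨fun h => ⟨Finset.mem_univ _, h⟩, fun h => h.2⟩

lemma tail_bound (N k : ℕ) (a : Fin k → Bool) (μ r : ℝ) (hμ : |μ| ≤ 1) :
    ((Finset.univ.filter (fun Y : Fin (k + 1) → Cube N =>
      r ≤ μ * ((Ia Y a).ncard : ℝ))).card : ℝ) ≤
      (2 * (2 : ℝ) ^ k) ^ N * Real.exp (-r + N / 2 ^ k * (μ + μ ^ 2)) := by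
  have h1 : ((Finset.univ.filter (fun Y : Fin (k + 1) → Cube N =>
      r ≤ μ * ((Ia Y a).ncard : ℝ))).card : ℝ) * Real.exp r ≤
      (2 * ((2 : ℝ) ^ k - 1 + Real.exp μ)) ^ N := by
    rw [← mgf N k a μ, ← nsmul_eq_mul]
    refine (Finset.card_nsmul_le_sum _ (fun Y => Real.exp (μ * ((Ia Y a).ncard : ℝ))) _ ?_).trans ?_
    · intro Y hY
      exact Real.exp_le_exp.2 (Finset.mem_filter.1 hY).2
    · exact Finset.sum_le_sum_of_subset_of_nonneg (Finset.filter_subset _ _)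
        (fun _ _ _ => (Real.exp_pos _).le)
  have hQ : (1 : ℝ) ≤ 2 ^ k := one_le_pow₀ (by norm_num)
  have h2 : (2 * ((2 : ℝ) ^ k - 1 + Real.exp μ)) ≤
      (2 * (2 : ℝ) ^ k) * Real.exp (1 / 2 ^ k * (μ + μ ^ 2)) := by
    have e1 := (abs_le.1 (Real.abs_exp_sub_one_sub_id_le hμ)).2
    have e2 := Real.add_one_le_exp (1 / 2 ^ k * (μ + μ ^ 2))
    have e3 : (2 * (2 : ℝ) ^ k) * (1 / 2 ^ k * (μ + μ ^ 2) + 1) = 2 * (2 ^ k + μ + μ ^ 2) := by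
      field_simp
      ring
    have e4 := mul_le_mul_of_nonneg_left e2 (by positivity : (0 : ℝ) ≤ 2 * 2 ^ k)
    linarith
  have h0 : (0 : ℝ) ≤ 2 * ((2 : ℝ) ^ k - 1 + Real.exp μ) := by
    have := Real.exp_pos μ
    linarith
  have h3 := pow_le_pow_left₀ h0 h2 N
  rw [mul_pow (2 * (2 : ℝ) ^ k), ← Real.exp_nat_mul] at h3
  rw [Real.exp_add, Real.exp_neg]
  have h4 := h1.trans h3
  rw [← le_div_iff₀ (Real.exp_pos r)] at h4
  refine h4.trans (le_of_eq ?_)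
  rw [div_eq_mul_inv, mul_assoc, mul_comm (Real.exp _) (Real.exp r)⁻¹]
  congr 3
  ring

/-- There is an absolute constant `C₂ > 0` such that for all `N` sufficiently
large (depending on `C₂`) and any number of vectors `k + 1` with
`1 ≤ k + 1 ≤ (log N)/2`: for i.i.d. uniform `Y_1, …, Y_{k+1}` in `Σ_N`, the
probability that `(Y_1, …, Y_{k+1})` is not admissible is at most
`N^{-2^{k+1}}`. -/
theorem admissible_whp :
    ∃ C₂ > (0 : ℝ), ∃ N₀ : ℕ, ∀ N : ℕ, N₀ ≤ N →
      ∀ k : ℕ, ((k : ℝ) + 1) ≤ Real.log N / 2 →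
        unifP {Y : Fin (k + 1) → Cube N | ¬ Admissible C₂ Y} ≤
          (N : ℝ) ^ (-((2 : ℝ) ^ (k + 1))) := by
  refine ⟨4, by norm_num, ⌈Real.exp 23⌉₊, fun N hN k hk => ?_⟩
  have hM : Real.exp 23 ≤ (N : ℝ) := (Nat.le_ceil _).trans (by exact_mod_cast hN)
  have hMpos : (0 : ℝ) < N := (Real.exp_pos _).trans_le hM
  set M : ℝ := (N : ℝ) with hMdef
  set L : ℝ := Real.log M with hL
  have hL23 : 23 ≤ L := (Real.le_log_iff_exp_le hMpos).2 hM
  have hME : M = Real.exp L := (Real.exp_log hMpos).symm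
  set Q : ℝ := (2 : ℝ) ^ k with hQdef
  have hQ : (1 : ℝ) ≤ Q := one_le_pow₀ (by norm_num)
  have h2Q : 2 * Q ≤ Real.exp (0.35 * L) := by
    have : 2 * Q = Real.exp (Real.log 2 * ((k : ℝ) + 1)) := by
      rw [← Real.rpow_def_of_pos (by norm_num), Real.rpow_add (by norm_num), Real.rpow_natCast]
      simp [hQdef]; ring
    rw [this]
    apply Real.exp_le_exp.2
    have := Real.log_two_lt_d9
    have h3 : Real.log 2 * ((k : ℝ) + 1) ≤ 0.7 * ((k : ℝ) + 1) := by
      apply mul_le_mul_of_nonneg_right _ (by positivity)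
      linarith
    linarith
  have hLe : L ≤ Real.exp (0.3 * L) := by
    have := Real.quadratic_le_exp_of_nonneg (by linarith : 0 ≤ 0.3 * L)
    nlinarith
  have hkey : (2 * Q) ^ 2 * L ≤ M := by
    calc (2 * Q) ^ 2 * L ≤ (Real.exp (0.35 * L)) ^ 2 * Real.exp (0.3 * L) := by gcongr
      _ = M := by
        rw [hME, ← Real.exp_nat_mul, ← Real.exp_add]
        congr 1
        push_cast
        ring
  have h2QM : 2 * Q ≤ M := by nlinarith
  set s : ℝ := Real.sqrt (M * L) with hs
  have hs2 : s ^ 2 = M * L := Real.sq_sqrt (by positivity)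
  have hs0 : 0 ≤ s := Real.sqrt_nonneg _
  set l : ℝ := 2 * Q * s / M with hl
  have hl0 : 0 < l := by
    have : 0 < s := Real.sqrt_pos.2 (by positivity)
    positivity
  have hl2 : l ^ 2 = (2 * Q) ^ 2 * L / M := by
    rw [hl, div_pow, mul_pow, hs2]; field_simp
  have hl1 : l ≤ 1 := by
    have : l ^ 2 ≤ 1 := by rw [hl2]; exact (div_le_one hMpos).2 hkey
    nlinarith
  have hexp : -(4 * s * l) + M / Q * l ^ 2 = -(4 * Q * L) := by
    have : s * l = 2 * Q * L := by
      have : s * l = 2 * Q * s ^ 2 / M := by rw [hl]; ring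
      rw [this, hs2]; field_simp
    rw [mul_assoc, this, hl2]; field_simp; ring
  set T : ℝ := (2 * Q) ^ N with hT
  have hT0 : 0 < T := by positivity
  have tb : ∀ a : Fin k → Bool, ∀ μ : ℝ, |μ| = l →
      ((Finset.univ.filter (fun Y : Fin (k + 1) → Cube N =>
      μ * (M / Q) + 4 * s * l ≤ μ * ((Ia Y a).ncard : ℝ))).card : ℝ) ≤
      T * Real.exp (-(4 * Q * L)) := by
    intro a μ hμ
    refine (tail_bound N k a μ _ (hμ.le.trans hl1)).trans (le_of_eq ?_)
    rw [← hexp, ← hμ, sq_abs]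
    congr 2
    ring
  have hcard : (Fintype.card (Fin (k + 1) → Cube N) : ℝ) = T := by
    simp [hT, hQdef]
    rw [← pow_succ', ← pow_mul, ← pow_mul, mul_comm]
  have hp : (2 : ℝ) ^ (-(k : ℝ)) * M = M / Q := by
    rw [Real.rpow_neg (by norm_num), Real.rpow_natCast]
    field_simp
    rw [hQdef]
  have hsub : {Y : Fin (k + 1) → Cube N | ¬ Admissible 4 Y} ⊆
      ((Finset.univ.biUnion (fun a : Fin k → Bool =>
        (Finset.univ.filter (fun Y : Fin (k + 1) → Cube N =>
          l * (M / Q) + 4 * s * l ≤ l * ((Ia Y a).ncard : ℝ))) ∪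
        (Finset.univ.filter (fun Y : Fin (k + 1) → Cube N =>
          (-l) * (M / Q) + 4 * s * l ≤ (-l) * ((Ia Y a).ncard : ℝ)))) :
          Finset (Fin (k + 1) → Cube N)) : Set (Fin (k + 1) → Cube N)) := by
    intro Y hY
    simp only [Set.mem_setOf_eq, Admissible, not_forall, not_le] at hY
    obtain ⟨a, ha⟩ := hY
    rw [hp] at ha
    simp only [Finset.coe_biUnion, Set.mem_iUnion, Finset.mem_coe, Finset.mem_union,
      Finset.mem_filter, Finset.mem_univ, true_and, Set.mem_univ, exists_prop, Finset.coe_univ]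
    refine ⟨a, ?_⟩
    rcases lt_abs.1 ha with h | h
    · left; nlinarith
    · right; nlinarith
  have hcnt : (({Y : Fin (k + 1) → Cube N | ¬ Admissible 4 Y}.ncard : ℕ) : ℝ) ≤
      Q * (2 * (T * Real.exp (-(4 * Q * L)))) := by
    have h1 := Set.ncard_le_ncard hsub (Finset.finite_toSet _)
    rw [Set.ncard_coe_finset] at h1
    have h2 := h1.trans Finset.card_biUnion_le
    refine (Nat.cast_le.2 h2).trans ?_
    push_cast
    refine (Finset.sum_le_card_nsmul _ _ (2 * (T * Real.exp (-(4 * Q * L)))) ?_).trans ?_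
    · intro a _
      refine (Nat.cast_le.2 (Finset.card_union_le _ _)).trans ?_
      push_cast
      have t1 := tb a l (abs_of_pos hl0)
      have t2 := tb a (-l) (by rw [abs_neg, abs_of_pos hl0])
      linarith
    · simp [hQdef]
  unfold unifP
  rw [hcard, div_le_iff₀ hT0]
  refine hcnt.trans ?_
  rw [Real.rpow_def_of_pos hMpos, ← hL, pow_succ, ← hQdef]
  have hfin : 2 * Q * Real.exp (-(4 * Q * L)) ≤ Real.exp (L * -(Q * 2)) := by
    calc 2 * Q * Real.exp (-(4 * Q * L)) ≤ Real.exp L * Real.exp (-(4 * Q * L)) := by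
          rw [← hME]; gcongr
      _ ≤ _ := by
        rw [← Real.exp_add]
        apply Real.exp_le_exp.2
        nlinarith
  nlinarith
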